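/- For 2 < α < 3 let R_α = ( (√π/2) · Γ((3-α)/2)/Γ((4-α)/2) · sin((α-1)π/2)/((α-1)π/2) )^{1/(α-2)} and let μ_α be the probability measure dμ_α(x) = C_α^{-1} R_α^{α-2} (R_α² − x²)^{−(α−1)/2} 𝟙(|x| < R_α) dx with C_α = √π Γ((3-α)/2)/Γ((4-α)/2). Then, as α ↗ 3, the measures μ_α converge weakly-* in the dual of C_0(ℝ) to the measure (1/2)(δ_{−1/2} + δ_{1/2}). -/

import Mathlib

open MeasureTheory Real ZeroAtInfty Filter

open scoped Topology

open Set in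
/-- The substitution `y = v ^ (1 / s)` on the unit interval. -/
lemma integral_comp_rpow_inv_unitInterval {s : ℝ} (hs : 0 < s) (h : ℝ → ℝ) :
    ∫ v in (0 : ℝ)..1, h (v ^ s⁻¹) = s * ∫ y in (0 : ℝ)..1, y ^ (s - 1) * h y := by
  have key := integral_comp_rpow_Ioi ((Iic (1 : ℝ)).indicator fun v => h (v ^ s⁻¹)) hs.ne'
  rw [setIntegral_indicator measurableSet_Iic, Ioi_inter_Iic,
    ← intervalIntegral.integral_of_le zero_le_one] at key
  rw [← key, ← intervalIntegral.integral_const_mul,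
    intervalIntegral.integral_of_le zero_le_one, ← Ioi_inter_Iic,
    ← setIntegral_indicator measurableSet_Iic]
  refine setIntegral_congr_fun measurableSet_Ioi fun y (hy : 0 < y) => ?_
  have hpow : (y ^ s) ^ s⁻¹ = y := by
    rw [← Real.rpow_mul hy.le, mul_inv_cancel₀ hs.ne', Real.rpow_one]
  by_cases hy1 : y ≤ 1
  · have : y ^ s ≤ 1 := Real.rpow_le_one hy.le hy1 hs.le
    simp [indicator, hy1, this, hpow, abs_of_pos hs, mul_assoc]
  · have : ¬ y ^ s ≤ 1 := not_le.2 (Real.one_lt_rpow (not_le.1 hy1) hs)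
    simp [indicator, hy1, this]

lemma mul_integral_sq_sub_sq_rpow_mul {s R : ℝ} (hs : 0 < s) (hR : 0 < R) (f : ℝ → ℝ) :
    s * ∫ x in (0 : ℝ)..R, (R ^ 2 - x ^ 2) ^ (s - 1) * f x =
      R ^ (2 * s - 1) *
        ∫ v in (0 : ℝ)..1, (2 - v ^ s⁻¹) ^ (s - 1) * f (R - R * v ^ s⁻¹) := by
  have hsub := intervalIntegral.integral_comp_sub_mul (a := 0) (b := 1)
    (fun x => (R ^ 2 - x ^ 2) ^ (s - 1) * f x) hR.ne' R
  have hpt : ∫ y in (0 : ℝ)..1, (R ^ 2 - (R - R * y) ^ 2) ^ (s - 1) * f (R - R * y) =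
      R ^ (2 * (s - 1)) *
        ∫ y in (0 : ℝ)..1, y ^ (s - 1) * ((2 - y) ^ (s - 1) * f (R - R * y)) := by
    rw [← intervalIntegral.integral_const_mul]
    refine intervalIntegral.integral_congr fun y hy => ?_
    rw [Set.uIcc_of_le zero_le_one] at hy
    have h2 : 0 ≤ 2 - y := by linarith [hy.2]
    have hfac : R ^ 2 - (R - R * y) ^ 2 = R ^ (2 : ℝ) * (y * (2 - y)) := by
      rw [Real.rpow_two]; ring
    simp only [hfac]
    rw [Real.mul_rpow (by positivity) (mul_nonneg hy.1 h2), Real.mul_rpow hy.1 h2,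
      ← Real.rpow_mul hR.le]
    ring
  have hcv := integral_comp_rpow_inv_unitInterval hs
    fun y => (2 - y) ^ (s - 1) * f (R - R * y)
  have hexp : R ^ (2 * s - 1) = R * R ^ (2 * (s - 1)) := by
    nth_rewrite 2 [← Real.rpow_one R]
    rw [← Real.rpow_add hR]
    ring_nf
  rw [hpt] at hsub
  simp only [mul_one, mul_zero, sub_zero, sub_self, smul_eq_mul] at hsub
  rw [hcv, hexp, ← mul_inv_cancel_left₀ hR.ne' (∫ x in (0 : ℝ)..R, _), ← hsub]
  ring

lemma intervalIntegrable_sq_sub_sq_rpow_mul {s R : ℝ} (hs : 0 < s) (hR : 0 < R) {f : ℝ → ℝ}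
    (hf : Continuous f) :
    IntervalIntegrable (fun x => (R ^ 2 - x ^ 2) ^ (s - 1) * f x) volume 0 R := by
  have h1 : IntervalIntegrable (fun x => (R - x) ^ (s - 1)) volume 0 R := by
    simpa using ((intervalIntegral.intervalIntegrable_rpow' (a := 0) (b := R)
      (r := s - 1) (by linarith)).comp_sub_left R).symm
  have h2 : ContinuousOn (fun x => (R + x) ^ (s - 1) * f x) (Set.uIcc 0 R) := by
    rw [Set.uIcc_of_le hR.le]
    refine ContinuousOn.mul (ContinuousOn.rpow_const (by fun_prop) fun x hx => ?_)
      hf.continuousOn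
    exact Or.inl (by linarith [hx.1] : (0 : ℝ) < R + x).ne'
  refine (h1.mul_continuousOn h2).congr fun x hx => ?_
  rw [Set.uIoc_of_le hR.le] at hx
  have e : R ^ 2 - x ^ 2 = (R - x) * (R + x) := by ring
  simp only [e]
  rw [Real.mul_rpow (by linarith [hx.2]) (by linarith [hx.1]), mul_assoc]

lemma mul_integral_neg_sq_sub_sq_rpow_mul {s R : ℝ} (hs : 0 < s) (hR : 0 < R) {f : ℝ → ℝ}
    (hf : Continuous f) :
    s * ∫ x in (-R)..R, (R ^ 2 - x ^ 2) ^ (s - 1) * f x =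
      R ^ (2 * s - 1) *
        ((∫ v in (0 : ℝ)..1, (2 - v ^ s⁻¹) ^ (s - 1) * f (-(R - R * v ^ s⁻¹))) +
          ∫ v in (0 : ℝ)..1, (2 - v ^ s⁻¹) ^ (s - 1) * f (R - R * v ^ s⁻¹)) := by
  have hneg := intervalIntegrable_sq_sub_sq_rpow_mul hs hR (hf.comp continuous_neg)
  have hint : IntervalIntegrable (fun x => (R ^ 2 - x ^ 2) ^ (s - 1) * f x) volume (-R) 0 := by
    rw [IntervalIntegrable.iff_comp_neg]
    simpa using hneg.symm
  have heq : ∫ x in (-R)..0, (R ^ 2 - x ^ 2) ^ (s - 1) * f x =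
      ∫ x in (0 : ℝ)..R, (R ^ 2 - x ^ 2) ^ (s - 1) * f (-x) := by
    have := intervalIntegral.integral_comp_neg (a := 0) (b := R)
      fun x => (R ^ 2 - x ^ 2) ^ (s - 1) * f x
    simpa using this.symm
  rw [← intervalIntegral.integral_add_adjacent_intervals hint
    (intervalIntegrable_sq_sub_sq_rpow_mul hs hR hf), heq, mul_add, mul_add,
    mul_integral_sq_sub_sq_rpow_mul hs hR f,
    mul_integral_sq_sub_sq_rpow_mul hs hR fun x => f (-x)]

lemma tendsto_integral_two_sub_rpow_mul {ι : Type*} {l : Filter ι} [l.IsCountablyGenerated]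
    {s R : ι → ℝ} {r : ℝ} (hs : Tendsto s l (𝓝[>] 0)) (hR : Tendsto R l (𝓝 r))
    {f : ℝ → ℝ} (hf : Continuous f) {M : ℝ} (hM : ∀ x, |f x| ≤ M) :
    Tendsto (fun i => ∫ v in (0 : ℝ)..1,
      (2 - v ^ (s i)⁻¹) ^ (s i - 1) * f (R i - R i * v ^ (s i)⁻¹)) l (𝓝 (2⁻¹ * f r)) := by
  have hs0 : Tendsto s l (𝓝 0) := hs.mono_right nhdsWithin_le_nhds
  have hpos : ∀ᶠ i in l, 0 < s i := hs.eventually self_mem_nhdsWithin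
  have hlim : 2⁻¹ * f r = ∫ _ in (0 : ℝ)..1, 2⁻¹ * f r := by simp
  rw [hlim]
  refine intervalIntegral.tendsto_integral_filter_of_dominated_convergence (fun _ => M) ?_ ?_
    intervalIntegrable_const ?_
  · exact Eventually.of_forall fun i =>
      ((by fun_prop : Measurable fun v : ℝ => (2 - v ^ (s i)⁻¹) ^ (s i - 1)).mul
        (hf.measurable.comp (by fun_prop))).aestronglyMeasurable
  · filter_upwards [hpos, hs0.eventually_lt_const zero_lt_one] with i hi hi1
    refine Eventually.of_forall fun v hv => ?_
    rw [Set.uIoc_of_le zero_le_one] at hv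
    have hle : v ^ (s i)⁻¹ ≤ 1 := Real.rpow_le_one hv.1.le hv.2 (by positivity)
    have hb : (2 - v ^ (s i)⁻¹) ^ (s i - 1) ≤ 1 :=
      Real.rpow_le_one_of_one_le_of_nonpos (by linarith) (by linarith)
    have hb0 : 0 ≤ (2 - v ^ (s i)⁻¹) ^ (s i - 1) := Real.rpow_nonneg (by linarith) _
    rw [Real.norm_eq_abs, abs_mul, abs_of_nonneg hb0]
    exact (mul_le_of_le_one_left (abs_nonneg _) hb).trans (hM _)
  · filter_upwards [compl_mem_ae_iff.2 (measure_singleton (1 : ℝ))] with v hv1 hv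
    rw [Set.uIoc_of_le zero_le_one] at hv
    have hlt : v < 1 := lt_of_le_of_ne hv.2 hv1
    have hv0 : Tendsto (fun i => v ^ (s i)⁻¹) l (𝓝 0) :=
      (tendsto_rpow_atTop_of_base_lt_one v (by linarith [hv.1]) hlt).comp
        (tendsto_inv_nhdsGT_zero.comp hs)
    have h1 : Tendsto (fun i => (2 - v ^ (s i)⁻¹) ^ (s i - 1)) l (𝓝 2⁻¹) := by
      have := (hv0.const_sub 2).rpow (hs0.sub_const 1) (by norm_num)
      simpa [Real.rpow_neg_one] using this
    have h2 : Tendsto (fun i => R i - R i * v ^ (s i)⁻¹) l (𝓝 r) := by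
      simpa using hR.sub (hR.mul hv0)
    exact h1.mul ((hf.tendsto r).comp h2)

lemma continuousAt_Gamma_of_pos {x : ℝ} (hx : 0 < x) : ContinuousAt Real.Gamma x :=
  (Real.differentiableAt_Gamma fun m => by
    have : (0 : ℝ) ≤ m := m.cast_nonneg
    linarith).continuousAt

/-- Euler's reflection formula removes the singularity of the base of `R_α` at `α = 3`. -/
lemma radius_base_eq {α : ℝ} (hα : α ∈ Set.Ioo (2 : ℝ) 3) :
    (√π / 2) * (Real.Gamma ((3 - α) / 2) / Real.Gamma ((4 - α) / 2)) *
      (Real.sin ((α - 1) * π / 2) / ((α - 1) * π / 2)) =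
    √π / ((α - 1) * Real.Gamma ((α - 1) / 2) * Real.Gamma ((4 - α) / 2)) := by
  obtain ⟨h2, h3⟩ := hα
  have hrefl := Real.Gamma_mul_Gamma_one_sub ((α - 1) / 2)
  rw [show 1 - (α - 1) / 2 = (3 - α) / 2 by ring,
    show π * ((α - 1) / 2) = (α - 1) * π / 2 by ring] at hrefl
  have hsin : 0 < Real.sin ((α - 1) * π / 2) :=
    Real.sin_pos_of_pos_of_lt_pi (by have := Real.pi_pos; nlinarith) (by nlinarith [Real.pi_pos])
  have hG1 : 0 < Real.Gamma ((α - 1) / 2) := Real.Gamma_pos_of_pos (by linarith)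
  have hG2 : 0 < Real.Gamma ((4 - α) / 2) := Real.Gamma_pos_of_pos (by linarith)
  have hα1 : 0 < α - 1 := by linarith
  have hpi := Real.pi_pos
  rw [eq_div_iff hsin.ne'] at hrefl
  field_simp
  linear_combination hrefl

lemma radius_base_pos {α : ℝ} (hα : α ∈ Set.Ioo (2 : ℝ) 3) :
    0 < (√π / 2) * (Real.Gamma ((3 - α) / 2) / Real.Gamma ((4 - α) / 2)) *
      (Real.sin ((α - 1) * π / 2) / ((α - 1) * π / 2)) := by
  rw [radius_base_eq hα]
  have hG1 : 0 < Real.Gamma ((α - 1) / 2) := Real.Gamma_pos_of_pos (by linarith [hα.1])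
  have hG2 : 0 < Real.Gamma ((4 - α) / 2) := Real.Gamma_pos_of_pos (by linarith [hα.2])
  have hα1 : 0 < α - 1 := by linarith [hα.1]
  positivity

lemma tendsto_Gamma_four_sub_div_two :
    Tendsto (fun α : ℝ => Real.Gamma ((4 - α) / 2)) (𝓝 3) (𝓝 √π) := by
  have h : ContinuousAt (fun α : ℝ => Real.Gamma ((4 - α) / 2)) 3 :=
    (continuousAt_Gamma_of_pos (by norm_num)).comp (by fun_prop)
  have := h.tendsto
  rwa [show ((4 : ℝ) - 3) / 2 = 1 / 2 by norm_num, Real.Gamma_one_half_eq] at this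

lemma tendsto_radius :
    Tendsto (fun α : ℝ => ((√π / 2) *
      (Real.Gamma ((3 - α) / 2) / Real.Gamma ((4 - α) / 2)) *
      (Real.sin ((α - 1) * π / 2) / ((α - 1) * π / 2))) ^ (1 / (α - 2)))
      (𝓝[Set.Ioo 2 3] 3) (𝓝 (1 / 2)) := by
  have hG : Tendsto (fun α : ℝ => Real.Gamma ((α - 1) / 2)) (𝓝 3) (𝓝 1) := by
    have h : ContinuousAt (fun α : ℝ => Real.Gamma ((α - 1) / 2)) 3 :=
      (continuousAt_Gamma_of_pos (by norm_num)).comp (by fun_prop)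
    have := h.tendsto
    rwa [show ((3 : ℝ) - 1) / 2 = 1 by norm_num, Real.Gamma_one] at this
  have hid : Tendsto (fun α : ℝ => α) (𝓝 3) (𝓝 3) := tendsto_id
  have hpi : √π ≠ 0 := (Real.sqrt_pos.2 Real.pi_pos).ne'
  have hbase := (tendsto_const_nhds (x := √π)).div
    (((hid.sub_const 1).mul hG).mul tendsto_Gamma_four_sub_div_two)
    (mul_ne_zero (by norm_num) hpi)
  have hexp : Tendsto (fun α : ℝ => 1 / (α - 2)) (𝓝 3) (𝓝 1) := by
    have := (tendsto_const_nhds (x := (1 : ℝ))).div (hid.sub_const 2) (by norm_num)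
    rwa [show (1 : ℝ) / (3 - 2) = 1 by norm_num] at this
  have hval : √π / ((3 - 1) * 1 * √π) = 1 / 2 := by
    field_simp
    norm_num
  rw [hval] at hbase
  have h := hbase.rpow hexp (Or.inl (by norm_num))
  rw [Real.rpow_one] at h
  refine (h.mono_left nhdsWithin_le_nhds).congr' ?_
  filter_upwards [self_mem_nhdsWithin] with α hα
  rw [radius_base_eq hα]
  rfl

lemma tendsto_normalization_mul :
    Tendsto (fun α : ℝ => √π * Real.Gamma ((3 - α) / 2) / Real.Gamma ((4 - α) / 2) *
      ((3 - α) / 2)) (𝓝[Set.Ioo 2 3] 3) (𝓝 1) := by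
  have hG : Tendsto (fun α : ℝ => Real.Gamma ((3 - α) / 2 + 1)) (𝓝 3) (𝓝 1) := by
    have h : ContinuousAt (fun α : ℝ => Real.Gamma ((3 - α) / 2 + 1)) 3 :=
      (continuousAt_Gamma_of_pos (by norm_num)).comp (by fun_prop)
    have := h.tendsto
    rwa [show ((3 : ℝ) - 3) / 2 + 1 = 1 by norm_num, Real.Gamma_one] at this
  have hpi : √π ≠ 0 := (Real.sqrt_pos.2 Real.pi_pos).ne'
  have h := (hG.const_mul √π).div tendsto_Gamma_four_sub_div_two hpi
  rw [mul_one, div_self hpi] at h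
  refine (h.mono_left nhdsWithin_le_nhds).congr' ?_
  filter_upwards [self_mem_nhdsWithin] with α hα
  have hs : (3 - α) / 2 ≠ 0 := by linarith [hα.2]
  simp only [Pi.div_apply]
  rw [Real.Gamma_add_one hs]
  ring

/-- Integration against the rescaled arcsine-type density, as an interval integral. -/
lemma integral_withDensity_sq_sub_sq_rpow {s R c : ℝ} (hR : 0 < R) (hc : 0 ≤ c) (f : ℝ → ℝ) :
    ∫ x, f x ∂(volume.withDensity fun x => ENNReal.ofReal
      (if |x| < R then c * (R ^ 2 - x ^ 2) ^ (s - 1) else 0)) =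
    c * ∫ x in (-R)..R, (R ^ 2 - x ^ 2) ^ (s - 1) * f x := by
  have hmeas : Measurable fun x : ℝ => ENNReal.ofReal
      (if |x| < R then c * (R ^ 2 - x ^ 2) ^ (s - 1) else 0) :=
    (Measurable.ite (measurableSet_lt measurable_norm measurable_const)
      (by fun_prop) measurable_const).ennreal_ofReal
  rw [integral_withDensity_eq_integral_toReal_smul hmeas
      (Eventually.of_forall fun _ => ENNReal.ofReal_lt_top),
    ← intervalIntegral.integral_const_mul, intervalIntegral.integral_of_le (by linarith),
    integral_Ioc_eq_integral_Ioo, ← integral_indicator measurableSet_Ioo]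
  congr 1 with x
  by_cases hx : |x| < R
  · have hnn : 0 ≤ c * (R ^ 2 - x ^ 2) ^ (s - 1) :=
      mul_nonneg hc (Real.rpow_nonneg (by nlinarith [sq_abs x, abs_nonneg x]) _)
    simp [hx, abs_lt.1 hx, ENNReal.toReal_ofReal hnn, mul_assoc]
  · have : x ∉ Set.Ioo (-R) R := fun h => hx (abs_lt.2 h)
    simp [hx, Set.indicator_of_notMem this]

/-- For `2 < α < 3` let `μ_α` be the probability measure with density
`C_α⁻¹ R_α^(α-2) (R_α² - x²)^(-(α-1)/2) 𝟙(|x| < R_α)`. Then, as `α ↗ 3`, the measures `μ_α`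
converge weakly-* in `(C₀(ℝ))^*` to `(1/2)(δ_{-1/2} + δ_{1/2})`, i.e. for every
`f ∈ C₀(ℝ)` the integrals `∫ f dμ_α` converge to `∫ f d((1/2)(δ_{-1/2} + δ_{1/2}))`. -/
theorem weak_star_convergence_to_two_deltas
    (R C : ℝ → ℝ) (μ : ℝ → Measure ℝ)
    (hR : ∀ α, R α = ((Real.sqrt π / 2) *
      (Real.Gamma ((3 - α) / 2) / Real.Gamma ((4 - α) / 2)) *
      (Real.sin ((α - 1) * π / 2) / ((α - 1) * π / 2))) ^ (1 / (α - 2)))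
    (hC : ∀ α, C α = Real.sqrt π * Real.Gamma ((3 - α) / 2) / Real.Gamma ((4 - α) / 2))
    (hμ : ∀ α, μ α = volume.withDensity fun x => ENNReal.ofReal
      (if |x| < R α then (C α)⁻¹ * R α ^ (α - 2) * (R α ^ 2 - x ^ 2) ^ (-(α - 1) / 2)
        else 0)) :
    ∀ f : C₀(ℝ, ℝ),
      Tendsto (fun α => ∫ x, f x ∂(μ α)) (nhdsWithin 3 (Set.Ioo 2 3))
        (nhds (∫ x, f x ∂((2⁻¹ : ENNReal) •
          (Measure.dirac (-(1 / 2) : ℝ) + Measure.dirac (1 / 2 : ℝ))))) := by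
  intro f
  have hlim : ∫ x, f x ∂((2⁻¹ : ENNReal) •
      (Measure.dirac (-(1 / 2) : ℝ) + Measure.dirac (1 / 2 : ℝ))) =
      (1 : ℝ)⁻¹ * (2⁻¹ * f (-(1 / 2)) + 2⁻¹ * f (1 / 2)) := by
    rw [integral_smul_measure, integral_add_measure (integrable_dirac (by simp))
      (integrable_dirac (by simp)), integral_dirac, integral_dirac]
    simp
    ring
  have hM : ∀ x, |f x| ≤ ‖f.toBCF‖ := fun x => f.toBCF.norm_coe_le_norm x
  have hfc : Continuous f := f.continuous
  have hs : Tendsto (fun α : ℝ => (3 - α) / 2) (𝓝[Set.Ioo 2 3] 3) (𝓝[>] 0) := by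
    refine tendsto_nhdsWithin_iff.2 ⟨?_, ?_⟩
    · have : ContinuousAt (fun α : ℝ => (3 - α) / 2) 3 := by fun_prop
      simpa using this.tendsto.mono_left nhdsWithin_le_nhds
    · filter_upwards [self_mem_nhdsWithin] with α hα
      exact Set.mem_Ioi.2 (by linarith [hα.2])
  have hRlim : Tendsto R (𝓝[Set.Ioo 2 3] 3) (𝓝 (1 / 2)) := by
    rw [funext hR]
    exact tendsto_radius
  have hClim : Tendsto (fun α => C α * ((3 - α) / 2)) (𝓝[Set.Ioo 2 3] 3) (𝓝 1) := by
    rw [funext hC]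
    exact tendsto_normalization_mul
  rw [hlim]
  refine ((hClim.inv₀ one_ne_zero).mul
    ((tendsto_integral_two_sub_rpow_mul hs hRlim (hfc.comp continuous_neg) fun x => hM (-x)).add
      (tendsto_integral_two_sub_rpow_mul hs hRlim hfc hM))).congr' ?_
  filter_upwards [self_mem_nhdsWithin] with α hα
  have hRpos : 0 < R α := hR α ▸ Real.rpow_pos_of_pos (radius_base_pos hα) _
  have hspos : 0 < (3 - α) / 2 := by linarith [hα.2]
  have hCpos : 0 < C α := by
    rw [hC]
    have := Real.Gamma_pos_of_pos hspos
    have : 0 < Real.Gamma ((4 - α) / 2) := Real.Gamma_pos_of_pos (by linarith [hα.2])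
    positivity
  have hmain := mul_integral_neg_sq_sub_sq_rpow_mul hspos hRpos hfc
  have hpow : R α ^ (α - 2) * R α ^ (2 * ((3 - α) / 2) - 1) = 1 := by
    rw [← Real.rpow_add hRpos]
    ring_nf
    exact Real.rpow_zero _
  rw [hμ, show -(α - 1) / 2 = (3 - α) / 2 - 1 by ring,
    integral_withDensity_sq_sub_sq_rpow hRpos (by positivity)]
  simp only [Function.comp_apply]
  set J := ∫ x in (-R α)..R α, (R α ^ 2 - x ^ 2) ^ ((3 - α) / 2 - 1) * f x
  rw [mul_inv, mul_assoc, mul_assoc]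
  congr 1
  rw [inv_mul_eq_iff_eq_mul₀ hspos.ne', mul_left_comm, hmain, ← mul_assoc, hpow, one_mul]
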